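/- Let k ≥ 0, z ∈ ℝ, and let σ : ℝ → ℝ be continuously differentiable with bounded derivative. Let y : [0,1] × ℝ → ℝ be smooth, such that t ↦ y(t,·) is a C¹ map into Schwartz space, and suppose ∂_t y(t,x) = −z σ(x) ∂_x y(t,x). Then H₁(y(1,·)) − H₁(y(0,·)) ≤ (e^{|z| ‖σ'‖_{L^∞}} − 1) ‖y(0,·)‖_{H¹}², where H₁(u) = (1/2)∫_ℝ (u² + (u')²) dx. -/

import Mathlib

open MeasureTheory SchwartzMap

/-- The squared `H¹` norm: `‖w‖_{H¹}² = ∫ (w² + (w')²)`. -/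
noncomputable def H1sq (w : ℝ → ℝ) : ℝ := ∫ x : ℝ, ((w x) ^ 2 + (deriv w x) ^ 2)

/-- The Camassa–Holm Hamiltonian `H₁(u) = (1/2) ∫ (u² + (u')²)`. -/
noncomputable def H1CH (u : ℝ → ℝ) : ℝ := (1 / 2) * ∫ x : ℝ, ((u x) ^ 2 + (deriv u x) ^ 2)

theorem Continuous.integrable_of_le_inv_one_add_sq {h : ℝ → ℝ} (hc : Continuous h) {C : ℝ}
    (hb : ∀ x, |h x| ≤ C * (1 + x ^ 2)⁻¹) : Integrable h :=
  (integrable_inv_one_add_sq.const_mul C).mono' hc.aestronglyMeasurable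
    (Filter.Eventually.of_forall hb)

/-- A continuous curve of Schwartz functions decays uniformly on compact time intervals. -/
theorem SchwartzMap.exists_uniform_decay {Y : ℝ → 𝓢(ℝ, ℝ)} (hY : Continuous Y) {s : Set ℝ}
    (hs : IsCompact s) :
    ∃ C, 0 ≤ C ∧ ∀ t ∈ s, ∀ x, |Y t x| ≤ C * (1 + x ^ 2)⁻¹ := by
  have hcont (m : ℕ) : Continuous fun t => SchwartzMap.seminorm ℝ m 0 (Y t) :=
    ((schwartz_withSeminorms ℝ ℝ ℝ).continuous_seminorm (m, 0)).comp hY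
  obtain ⟨C₀, h₀⟩ := hs.bddAbove_image (hcont 0).continuousOn
  obtain ⟨C₂, h₂⟩ := hs.bddAbove_image (hcont 2).continuousOn
  refine ⟨|C₀ + C₂|, abs_nonneg _, fun t ht x => ?_⟩
  have b₀ := (norm_le_seminorm ℝ (Y t) x).trans (h₀ ⟨t, ht, rfl⟩)
  have b₂ := (norm_pow_mul_le_seminorm ℝ (Y t) 2 x).trans (h₂ ⟨t, ht, rfl⟩)
  rw [← div_eq_mul_inv, le_div_iff₀ (by positivity)]
  simp only [Real.norm_eq_abs, sq_abs] at b₀ b₂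
  linarith [le_abs_self (C₀ + C₂)]

theorem SchwartzMap.continuous_eval_curve {Y : ℝ → 𝓢(ℝ, ℝ)} (hY : Continuous Y) (x : ℝ) :
    Continuous fun t => Y t x := by
  have h := (toBoundedContinuousFunctionCLM ℝ ℝ ℝ).continuous.comp hY
  exact (continuous_eval_const (F := BoundedContinuousFunction ℝ ℝ) x).comp h

theorem abs_le_mul_one_add_sq_of_abs_deriv_le {σ : ℝ → ℝ} (hσ : Differentiable ℝ σ) {M : ℝ}
    (hM : ∀ x, |deriv σ x| ≤ M) (x : ℝ) : |σ x| ≤ (|σ 0| + M) * (1 + x ^ 2) := by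
  have h := Convex.norm_image_sub_le_of_norm_deriv_le (f := σ) (s := Set.univ) (C := M)
    (fun x _ => hσ x) (fun x _ => hM x) convex_univ (Set.mem_univ 0) (Set.mem_univ x)
  simp only [Real.norm_eq_abs, sub_zero] at h
  have hM0 : 0 ≤ M := (abs_nonneg _).trans (hM 0)
  have h1 : |x| ≤ 1 + x ^ 2 := by nlinarith [sq_nonneg (|x| - 1), sq_abs x, abs_nonneg x]
  have h2 : |σ x| ≤ |σ 0| + |σ x - σ 0| := by
    simpa using abs_add_le (σ 0) (σ x - σ 0)
  nlinarith [mul_le_mul_of_nonneg_left h1 hM0, mul_nonneg (abs_nonneg (σ 0)) (sq_nonneg x)]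

theorem abs_mul_mul_le_of_decay {s b c w A B C : ℝ} (hw : 0 < w) (hB : 0 ≤ B)
    (hs : |s| ≤ A * w) (hb : |b| ≤ B * w⁻¹) (hc : |c| ≤ C * w⁻¹) :
    |s * b * c| ≤ A * B * C * w⁻¹ := by
  have hA : 0 ≤ A * w := (abs_nonneg _).trans hs
  calc |s * b * c| = |s| * |b| * |c| := by rw [abs_mul, abs_mul]
    _ ≤ (A * w) * (B * w⁻¹) * (C * w⁻¹) := by gcongr
    _ = A * B * C * w⁻¹ := by field_simp

/-- The time derivative of the density `u² + (u')²` along `∂ₜ u = -z σ u'`. -/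
noncomputable def transportDensity (z : ℝ) (σ u : ℝ → ℝ) (x : ℝ) : ℝ :=
  -(2 * z) * (σ x * deriv u x * u x + deriv σ x * deriv u x * deriv u x
    + σ x * deriv u x * deriv (deriv u) x)

theorem abs_transportDensity_le {z : ℝ} {σ u : ℝ → ℝ} {A M C₀ C₁ C₂ x : ℝ}
    (hσ : |σ x| ≤ A * (1 + x ^ 2)) (hM : |deriv σ x| ≤ M) (h₁nn : 0 ≤ C₁)
    (h₀ : |u x| ≤ C₀ * (1 + x ^ 2)⁻¹) (h₁ : |deriv u x| ≤ C₁ * (1 + x ^ 2)⁻¹)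
    (h₂ : |deriv (deriv u) x| ≤ C₂ * (1 + x ^ 2)⁻¹) :
    |transportDensity z σ u x| ≤
      |2 * z| * (A * C₁ * C₀ + M * C₁ * C₁ + A * C₁ * C₂) * (1 + x ^ 2)⁻¹ := by
  have hw : 0 < 1 + x ^ 2 := by positivity
  have hM0 : 0 ≤ M := (abs_nonneg _).trans hM
  have e₀ := abs_mul_mul_le_of_decay hw h₁nn hσ h₁ h₀
  have e₁ := abs_mul_mul_le_of_decay hw h₁nn
    (hM.trans (le_mul_of_one_le_right hM0 (by nlinarith [sq_nonneg x]))) h₁ h₁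
  have e₂ := abs_mul_mul_le_of_decay hw h₁nn hσ h₁ h₂
  rw [transportDensity, abs_mul, abs_neg, mul_assoc |2 * z|]
  refine mul_le_mul_of_nonneg_left ?_ (abs_nonneg _)
  exact ((abs_add_three _ _ _).trans (add_le_add_three e₀ e₁ e₂)).trans_eq (by ring)

theorem SchwartzMap.coe_derivCLM (f : 𝓢(ℝ, ℝ)) : ⇑(derivCLM ℝ ℝ f) = deriv f :=
  funext fun x => derivCLM_apply ℝ f x

theorem SchwartzMap.exists_uniform_decay_deriv {Y : ℝ → 𝓢(ℝ, ℝ)} (hY : Continuous Y) {s : Set ℝ}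
    (hs : IsCompact s) :
    ∃ C₀ C₁ C₂, 0 ≤ C₀ ∧ 0 ≤ C₁ ∧ ∀ t ∈ s, ∀ x, |Y t x| ≤ C₀ * (1 + x ^ 2)⁻¹ ∧
      |deriv (Y t) x| ≤ C₁ * (1 + x ^ 2)⁻¹ ∧ |deriv (deriv (Y t)) x| ≤ C₂ * (1 + x ^ 2)⁻¹ := by
  have hY₁ : Continuous fun t => derivCLM ℝ ℝ (Y t) := (derivCLM ℝ ℝ).continuous.comp hY
  have hY₂ : Continuous fun t => derivCLM ℝ ℝ (derivCLM ℝ ℝ (Y t)) :=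
    (derivCLM ℝ ℝ).continuous.comp hY₁
  obtain ⟨C₀, n₀, h₀⟩ := exists_uniform_decay hY hs
  obtain ⟨C₁, n₁, h₁⟩ := exists_uniform_decay hY₁ hs
  obtain ⟨C₂, -, h₂⟩ := exists_uniform_decay hY₂ hs
  simp only [coe_derivCLM] at h₁ h₂
  exact ⟨C₀, C₁, C₂, n₀, n₁, fun t ht x => ⟨h₀ t ht x, h₁ t ht x, h₂ t ht x⟩⟩

theorem SchwartzMap.continuous_deriv (f : 𝓢(ℝ, ℝ)) : Continuous (deriv f) := by
  rw [← coe_derivCLM]; exact (derivCLM ℝ ℝ f).continuous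

theorem SchwartzMap.hasDerivAt_deriv (f : 𝓢(ℝ, ℝ)) (x : ℝ) :
    HasDerivAt (deriv f) (deriv (deriv f) x) x := by
  rw [← coe_derivCLM]; exact (derivCLM ℝ ℝ f).differentiableAt.hasDerivAt

theorem SchwartzMap.continuous_transportDensity (z : ℝ) {σ : ℝ → ℝ} (hσ : ContDiff ℝ 1 σ)
    (f : 𝓢(ℝ, ℝ)) : Continuous (transportDensity z σ f) := by
  have h0 := hσ.continuous
  have h1 := hσ.continuous_deriv le_rfl
  have h2 := f.continuous
  have h3 := f.continuous_deriv
  have h4 : Continuous (deriv (deriv f)) := by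
    rw [← f.coe_derivCLM]; exact (derivCLM ℝ ℝ f).continuous_deriv
  unfold transportDensity
  fun_prop

theorem sq_add_sq_le_of_decay {a b x C₀ C₁ : ℝ} (h₀ : |a| ≤ C₀ * (1 + x ^ 2)⁻¹)
    (h₁ : |b| ≤ C₁ * (1 + x ^ 2)⁻¹) :
    |a ^ 2 + b ^ 2| ≤ (C₀ ^ 2 + C₁ ^ 2) * (1 + x ^ 2)⁻¹ := by
  have hw : (1 + x ^ 2)⁻¹ ≤ 1 := inv_le_one_of_one_le₀ (by nlinarith [sq_nonneg x])
  have hw0 : 0 < (1 + x ^ 2)⁻¹ := by positivity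
  have ha : a ^ 2 ≤ (C₀ * (1 + x ^ 2)⁻¹) ^ 2 := by rw [← sq_abs]; gcongr
  have hb : b ^ 2 ≤ (C₁ * (1 + x ^ 2)⁻¹) ^ 2 := by rw [← sq_abs b]; gcongr
  rw [abs_of_nonneg (by positivity)]
  nlinarith [mul_le_mul_of_nonneg_left (mul_le_of_le_one_left hw0.le hw)
    (add_nonneg (sq_nonneg C₀) (sq_nonneg C₁))]

theorem SchwartzMap.integral_transportDensity_le (z : ℝ) {σ : ℝ → ℝ} (hσ : ContDiff ℝ 1 σ) {M : ℝ}
    (hM : ∀ x, |deriv σ x| ≤ M) (f : 𝓢(ℝ, ℝ)) :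
    ∫ x, transportDensity z σ f x ≤ |z| * M * H1sq f := by
  obtain ⟨C₀, C₁, C₂, hn₀, hn₁, hC⟩ :=
    exists_uniform_decay_deriv (continuous_const (y := f)) (isCompact_singleton (x := (0 : ℝ)))
  replace hC := hC 0 rfl
  have hσd : Differentiable ℝ σ := hσ.differentiable one_ne_zero
  have hA := abs_le_mul_one_add_sq_of_abs_deriv_le hσd hM
  have hE : Integrable fun x => f x ^ 2 + deriv f x ^ 2 :=
    ((f.continuous.pow 2).add (f.continuous_deriv.pow 2)).integrable_of_le_inv_one_add_sq
      fun x => sq_add_sq_le_of_decay (hC x).1 (hC x).2.1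
  have hT : Integrable (transportDensity z σ f) :=
    (f.continuous_transportDensity z hσ).integrable_of_le_inv_one_add_sq fun x =>
      abs_transportDensity_le (hA x) (hM x) hn₁ (hC x).1 (hC x).2.1 (hC x).2.2
  have hF : Integrable fun x => z * (σ x * f x * f x + σ x * deriv f x * deriv f x) := by
    refine Integrable.const_mul (Integrable.add ?_ ?_) z
    · exact ((hσ.continuous.mul f.continuous).mul f.continuous).integrable_of_le_inv_one_add_sq
        fun x => abs_mul_mul_le_of_decay (by positivity) hn₀ (hA x) (hC x).1 (hC x).1
    · exact ((hσ.continuous.mul f.continuous_deriv).mul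
        f.continuous_deriv).integrable_of_le_inv_one_add_sq
        fun x => abs_mul_mul_le_of_decay (by positivity) hn₁ (hA x) (hC x).2.1 (hC x).2.1
  have hR : Integrable fun x => z * deriv σ x * (f x ^ 2 - deriv f x ^ 2) := by
    refine (hE.const_mul (|z| * M)).mono' ?_ (Filter.Eventually.of_forall fun x => ?_)
    · exact ((continuous_const.mul (hσ.continuous_deriv le_rfl)).mul
        ((f.continuous.pow 2).sub (f.continuous_deriv.pow 2))).aestronglyMeasurable
    · rw [Real.norm_eq_abs, abs_mul, abs_mul]
      have h : |f x ^ 2 - deriv f x ^ 2| ≤ f x ^ 2 + deriv f x ^ 2 := by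
        rw [abs_le]
        constructor <;> nlinarith [sq_nonneg (f x), sq_nonneg (deriv f x)]
      have hM0 : 0 ≤ M := (abs_nonneg _).trans (hM 0)
      gcongr
      exact hM x
  have hder (x : ℝ) : HasDerivAt (fun x => z * (σ x * f x * f x + σ x * deriv f x * deriv f x))
      (z * deriv σ x * (f x ^ 2 - deriv f x ^ 2) - transportDensity z σ f x) x := by
    have hf : HasDerivAt f (deriv f x) x := f.differentiableAt.hasDerivAt
    have hs := (hσd x).hasDerivAt
    have hf' := f.hasDerivAt_deriv x
    refine ((((hs.mul hf).mul hf).add ((hs.mul hf').mul hf')).const_mul z).congr_deriv ?_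
    simp only [transportDensity, Pi.mul_apply]
    ring
  have hzero := integral_eq_zero_of_hasDerivAt_of_integrable hder (hR.sub hT) hF
  rw [integral_sub hR hT, sub_eq_zero] at hzero
  rw [← hzero, H1sq, ← integral_const_mul]
  refine integral_mono hR (hE.const_mul _) fun x => ?_
  have h1 : z * deriv σ x ≤ |z| * M :=
    (le_abs_self _).trans (by rw [abs_mul]; gcongr; exact hM x)
  have h2 : -(z * deriv σ x) ≤ |z| * M :=
    (neg_le_abs _).trans (by rw [abs_mul]; gcongr; exact hM x)
  dsimp only
  nlinarith [mul_le_mul_of_nonneg_right h1 (sq_nonneg (f x)),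
    mul_le_mul_of_nonneg_right h2 (sq_nonneg (deriv f x))]

/-- Equality of mixed partial derivatives for a function of two real variables. -/
theorem hasDerivAt_partial_of_contDiffOn {g : ℝ × ℝ → ℝ} {U : Set (ℝ × ℝ)} (hU : IsOpen U)
    (hg : ContDiffOn ℝ 2 g U) {v w : ℝ → ℝ} {t x d : ℝ} (hp : (t, x) ∈ U)
    (hv : ∀ᶠ s in nhds t, HasDerivAt (fun x' => g (s, x')) (v s) x)
    (hw : ∀ᶠ x' in nhds x, HasDerivAt (fun s => g (s, x')) (w x') t)
    (hd : HasDerivAt w d x) : HasDerivAt v d t := by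
  have hgp : ContDiffAt ℝ 2 g (t, x) := hg.contDiffAt (hU.mem_nhds hp)
  have hsymm := (hgp.isSymmSndFDerivAt (by simp)).eq (0, 1) (1, 0)
  have hdiff : HasFDerivAt (fderiv ℝ g) (fderiv ℝ (fderiv ℝ g) (t, x)) (t, x) :=
    ((hgp.fderiv_right (m := 1) (by norm_num)).differentiableAt one_ne_zero).hasFDerivAt
  have hcv : HasDerivAt (fun s : ℝ => (s, x)) ((1 : ℝ), (0 : ℝ)) t :=
    (hasDerivAt_id t).prodMk (hasDerivAt_const t x)
  have hcw : HasDerivAt (fun x' : ℝ => (t, x')) ((0 : ℝ), (1 : ℝ)) x :=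
    (hasDerivAt_const x t).prodMk (hasDerivAt_id x)
  have hv' : v =ᶠ[nhds t] fun s => fderiv ℝ g (s, x) (0, 1) := by
    filter_upwards [hv, hcv.continuousAt.preimage_mem_nhds (hU.mem_nhds hp)] with s hs hsU
    have hgs : DifferentiableAt ℝ g (s, x) :=
      (hg.contDiffAt (hU.mem_nhds hsU)).differentiableAt two_ne_zero
    exact hs.unique (hgs.hasFDerivAt.comp_hasDerivAt x
      ((hasDerivAt_const x s).prodMk (hasDerivAt_id x)))
  have hw' : w =ᶠ[nhds x] fun x' => fderiv ℝ g (t, x') (1, 0) := by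
    filter_upwards [hw, hcw.continuousAt.preimage_mem_nhds (hU.mem_nhds hp)] with x' hs hsU
    have hgs : DifferentiableAt ℝ g (t, x') :=
      (hg.contDiffAt (hU.mem_nhds hsU)).differentiableAt two_ne_zero
    exact hs.unique (hgs.hasFDerivAt.comp_hasDerivAt t
      ((hasDerivAt_id t).prodMk (hasDerivAt_const t x')))
  generalize fderiv ℝ (fderiv ℝ g) (t, x) = L at hdiff hsymm
  generalize fderiv ℝ g = g' at hdiff hv' hw'
  have h1 : HasDerivAt (fun s => g' (s, x) (0, 1)) (L (1, 0) (0, 1)) t :=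
    (ContinuousLinearMap.apply ℝ ℝ ((0 : ℝ), (1 : ℝ))).hasFDerivAt.comp_hasDerivAt t
      (HasFDerivAt.comp_hasDerivAt (f := fun s : ℝ => (s, x)) t hdiff hcv)
  have h2 : HasDerivAt (fun x' => g' (t, x') (1, 0)) (L (0, 1) (1, 0)) x :=
    (ContinuousLinearMap.apply ℝ ℝ ((1 : ℝ), (0 : ℝ))).hasFDerivAt.comp_hasDerivAt x
      (HasFDerivAt.comp_hasDerivAt (f := fun x' : ℝ => (t, x')) x hdiff hcw)
  rw [hd.unique (h2.congr_of_eventuallyEq hw'), hsymm]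
  exact h1.congr_of_eventuallyEq hv'

/-- Let `k ≥ 0`, `z ∈ ℝ`, and `σ` be C¹ with derivative bounded by `M`. If
`y : [0,1] × ℝ → ℝ` is smooth, `t ↦ y(t,·)` is a C¹ map into Schwartz space (encoded here by
the Schwartz-valued curve being continuous, the joint function being smooth on `[0,1] × ℝ`, and
the time derivative existing pointwise), and `∂_t y = −z σ ∂_x y`, then
`H₁(y(1,·)) − H₁(y(0,·)) ≤ (e^{|z| ‖σ'‖_{L^∞}} − 1) ‖y(0,·)‖_{H¹}²`. -/
theorem stmt3 (k : ℝ) (hk : 0 ≤ k) (z : ℝ) (σ : ℝ → ℝ) (hσ : ContDiff ℝ 1 σ) (M : ℝ)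
    (hM : ∀ x : ℝ, |deriv σ x| ≤ M)
    (y : ℝ → 𝓢(ℝ, ℝ))
    (hsmooth : ContDiffOn ℝ (⊤ : ℕ∞) (fun p : ℝ × ℝ => y p.1 p.2) (Set.Icc 0 1 ×ˢ Set.univ))
    (hcont : Continuous y)
    (hPDE : ∀ t ∈ Set.Icc (0 : ℝ) 1, ∀ x : ℝ,
      HasDerivWithinAt (fun s => y s x) (-(z * σ x * deriv (⇑(y t)) x)) (Set.Icc 0 1) t) :
    H1CH (⇑(y 1)) - H1CH (⇑(y 0)) ≤ (Real.exp (|z| * M) - 1) * H1sq (⇑(y 0)) := by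
  have hσd : Differentiable ℝ σ := hσ.differentiable one_ne_zero
  have hA := abs_le_mul_one_add_sq_of_abs_deriv_le hσd hM
  have hM0 : 0 ≤ M := (abs_nonneg _).trans (hM 0)
  obtain ⟨C₀, C₁, C₂, hn₀, hn₁, hC⟩ :=
    exists_uniform_decay_deriv hcont (isCompact_Icc (a := (0 : ℝ)) (b := 1))
  have hEcont (t : ℝ) : Continuous fun x => y t x ^ 2 + deriv (y t) x ^ 2 :=
    ((y t).continuous.pow 2).add ((y t).continuous_deriv.pow 2)
  have hEbound (t : ℝ) (ht : t ∈ Set.Icc (0 : ℝ) 1) (x : ℝ) :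
      |y t x ^ 2 + deriv (y t) x ^ 2| ≤ (C₀ ^ 2 + C₁ ^ 2) * (1 + x ^ 2)⁻¹ :=
    sq_add_sq_le_of_decay (hC t ht x).1 (hC t ht x).2.1
  have hy (t : ℝ) (ht : t ∈ Set.Ioo (0 : ℝ) 1) (x : ℝ) :
      HasDerivAt (fun s => y s x) (-(z * σ x * deriv (y t) x)) t :=
    (hPDE t (Set.Ioo_subset_Icc_self ht) x).hasDerivAt (Icc_mem_nhds ht.1 ht.2)
  have hy' (t : ℝ) (ht : t ∈ Set.Ioo (0 : ℝ) 1) (x : ℝ) :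
      HasDerivAt (fun s => deriv (y s) x)
        (-(z * deriv σ x * deriv (y t) x + z * σ x * deriv (deriv (y t)) x)) t := by
    refine hasDerivAt_partial_of_contDiffOn (g := fun p => y p.1 p.2)
      (U := Set.Ioo 0 1 ×ˢ Set.univ) (w := fun x => -(z * σ x * deriv (y t) x))
      (isOpen_Ioo.prod isOpen_univ) (contDiffOn_infty.1 (hsmooth.mono ?_) 2)
      ⟨ht, Set.mem_univ x⟩ (.of_forall fun s => (y s).differentiableAt.hasDerivAt)
      (.of_forall fun x' => hy t ht x') ?_
    · exact Set.prod_mono Set.Ioo_subset_Icc_self subset_rfl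
    · exact (((hσd x).hasDerivAt.const_mul z).mul ((y t).hasDerivAt_deriv x)).neg
  have hderiv (t : ℝ) (ht : t ∈ Set.Ioo (0 : ℝ) 1) :
      HasDerivAt (fun s => H1sq (y s)) (∫ x, transportDensity z σ (y t) x) t := by
    refine (hasDerivAt_integral_of_dominated_loc_of_deriv_le
      (F' := fun s x => transportDensity z σ (y s) x)
      (bound := fun x => |2 * z| * ((|σ 0| + M) * C₁ * C₀ + M * C₁ * C₁
        + (|σ 0| + M) * C₁ * C₂) * (1 + x ^ 2)⁻¹) (Ioo_mem_nhds ht.1 ht.2)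
      (.of_forall fun s => (hEcont s).aestronglyMeasurable)
      ((hEcont t).integrable_of_le_inv_one_add_sq (hEbound t (Set.Ioo_subset_Icc_self ht)))
      ((y t).continuous_transportDensity z hσ).aestronglyMeasurable
      (.of_forall fun x s hs => ?_)
      (integrable_inv_one_add_sq.const_mul _) (.of_forall fun x s hs => ?_)).2
    · have h := hC s (Set.Ioo_subset_Icc_self hs) x
      exact abs_transportDensity_le (hA x) (hM x) hn₁ h.1 h.2.1 h.2.2
    · refine (((hy s hs x).pow 2).add ((hy' s hs x).pow 2)).congr_deriv ?_
      simp only [transportDensity]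
      push_cast
      ring
  have hNcont : ContinuousOn (fun t => H1sq (y t)) (Set.Icc 0 1) := by
    refine continuousOn_of_dominated (fun t _ => (hEcont t).aestronglyMeasurable)
      (fun t ht => .of_forall (hEbound t ht)) (integrable_inv_one_add_sq.const_mul _)
      (.of_forall fun x => Continuous.continuousOn ?_)
    have h₁ : Continuous fun t => deriv (y t) x := by
      simpa only [Function.comp_apply, coe_derivCLM] using
        continuous_eval_curve ((derivCLM ℝ ℝ).continuous.comp hcont) x
    exact ((continuous_eval_curve hcont x).pow 2).add (h₁.pow 2)
  have hGderiv (t : ℝ) (ht : t ∈ Set.Ioo (0 : ℝ) 1) :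
      HasDerivAt (fun s => Real.exp (-(|z| * M) * s) * H1sq (y s))
        (Real.exp (-(|z| * M) * t) *
          ((∫ x, transportDensity z σ (y t) x) - |z| * M * H1sq (y t))) t := by
    refine ((((hasDerivAt_id t).const_mul (-(|z| * M))).exp).mul (hderiv t ht)).congr_deriv ?_
    simp only [id]
    ring
  have hanti : AntitoneOn (fun s => Real.exp (-(|z| * M) * s) * H1sq (y s)) (Set.Icc 0 1) := by
    refine antitoneOn_of_deriv_nonpos (convex_Icc 0 1) ?_ ?_ ?_
    · exact (by fun_prop : Continuous fun s => Real.exp (-(|z| * M) * s)).continuousOn.mul hNcont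
    · rw [interior_Icc]
      exact fun t ht => (hGderiv t ht).differentiableAt.differentiableWithinAt
    · rw [interior_Icc]
      intro t ht
      rw [(hGderiv t ht).deriv]
      exact mul_nonpos_of_nonneg_of_nonpos (Real.exp_pos _).le
        (sub_nonpos.2 ((y t).integral_transportDensity_le z hσ hM))
  have hgron : H1sq (y 1) ≤ Real.exp (|z| * M) * H1sq (y 0) := by
    have h := hanti (Set.left_mem_Icc.2 zero_le_one) (Set.right_mem_Icc.2 zero_le_one) zero_le_one
    simp only [mul_one, mul_zero, Real.exp_zero, one_mul, Real.exp_neg] at h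
    rwa [inv_mul_le_iff₀ (Real.exp_pos _)] at h
  have h0 : 0 ≤ H1sq (y 0) := integral_nonneg fun x => by positivity
  have hexp : 1 ≤ Real.exp (|z| * M) := Real.one_le_exp (by positivity)
  change 1 / 2 * H1sq (y 1) - 1 / 2 * H1sq (y 0) ≤ _
  nlinarith [mul_nonneg (sub_nonneg.2 hexp) h0]
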